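/- Let (x₁, x₂) jointly follow an m-squared-family density p(x|θ) = ‖Θψ(x)‖₂²/z(θ) with respect to μ, where μ(dx) = μ₁(dx₁|x₂)μ₂(dx₂), and define ψ_{1|2}(x₁) = ψ((x₁, x₂)). Then the marginal distribution of x₂ has density with respect to μ₂ equal to Tr(ΘᵀΘ K_{μ₁(·|x₂), ψ_{1|2}}) / Tr(ΘᵀΘ K_{μ,ψ}), where K_{μ₁(·|x₂), ψ_{1|2}} = ∫ ψ_{1|2}(x₁)ψ_{1|2}(x₁)ᵀ μ₁(dx₁|x₂) and K_{μ,ψ} = ∫_X ψ(x)ψ(x)ᵀ μ(dx). -/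

import Mathlib

open MeasureTheory Matrix ProbabilityTheory

theorem sum_mulVec_sq_eq_sum {m n : ℕ} (Θ : Matrix (Fin m) (Fin n) ℝ) (v : Fin n → ℝ) :
    ∑ i, (Θ.mulVec v i) ^ 2 = ∑ j, ∑ k, (Θᵀ * Θ) j k * (v k * v j) := by
  calc ∑ i, (Θ.mulVec v i) ^ 2 = Θ *ᵥ v ⬝ᵥ Θ *ᵥ v := by simp only [dotProduct, sq]
    _ = v ⬝ᵥ (Θᵀ * Θ) *ᵥ v := by
      rw [← Matrix.mulVec_mulVec, Matrix.mulVec_transpose, dotProduct_comm v,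
        ← Matrix.dotProduct_mulVec]
    _ = ∑ j, ∑ k, (Θᵀ * Θ) j k * (v k * v j) := by
      simp only [dotProduct, Matrix.mulVec, Finset.mul_sum]
      exact Finset.sum_congr rfl fun j _ => Finset.sum_congr rfl fun k _ => by ring

section SecondMoment

variable {α : Type*} [MeasurableSpace α] {ν : Measure α} {m n : ℕ}
  (Θ : Matrix (Fin m) (Fin n) ℝ) {f : α → Fin n → ℝ}

theorem integrable_sum_mulVec_sq (hf : ∀ i j, Integrable (fun x => f x i * f x j) ν) :
    Integrable (fun x => ∑ i, (Θ.mulVec (f x) i) ^ 2) ν := by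
  simp only [sum_mulVec_sq_eq_sum]
  exact integrable_finsetSum _ fun j _ => integrable_finsetSum _ fun k _ =>
    (hf k j).const_mul _

theorem integral_sum_mulVec_sq (hf : ∀ i j, Integrable (fun x => f x i * f x j) ν) :
    ∫ x, ∑ i, (Θ.mulVec (f x) i) ^ 2 ∂ν =
      (Θᵀ * Θ * Matrix.of fun i j => ∫ x, f x i * f x j ∂ν).trace := by
  simp only [sum_mulVec_sq_eq_sum, Matrix.trace, Matrix.diag_apply,
    Matrix.mul_apply (M := Θᵀ * Θ), Matrix.of_apply]
  refine (integral_finsetSum _ fun j _ => integrable_finsetSum _ fun k _ =>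
    (hf k j).const_mul _).trans (Finset.sum_congr rfl fun j _ => ?_)
  exact (integral_finsetSum _ fun k _ => (hf k j).const_mul _).trans
    (Finset.sum_congr rfl fun k _ => integral_const_mul _ _)

end SecondMoment

/-- If `(x₁, x₂)` jointly follows an m-squared-family density with base
measure disintegrating as `μ(dx) = μ₁(dx₁|x₂) μ₂(dx₂)`, then the marginal distribution of
`x₂` has density `Tr(ΘᵀΘ K_{μ₁(·|x₂), ψ₁₂}) / Tr(ΘᵀΘ K_{μ,ψ})` with respect to `μ₂`. -/
theorem stmt_5 {m n : ℕ} {X₁ X₂ : Type*} [MeasurableSpace X₁] [MeasurableSpace X₂]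
    (μ : Measure (X₁ × X₂)) (μ₂ : Measure X₂) [SFinite μ₂]
    (κ : Kernel X₂ X₁) [IsSFiniteKernel κ]
    (hdis : μ = (μ₂.compProd κ).map Prod.swap)
    (ψ : X₁ × X₂ → Fin n → ℝ) (hψ : Measurable ψ)
    (Θ : Matrix (Fin m) (Fin n) ℝ)
    (z : ℝ) (hzdef : z = ∫ x, ∑ i, (Θ.mulVec (ψ x) i) ^ 2 ∂μ)
    (hzInt : Integrable (fun x => ∑ i, (Θ.mulVec (ψ x) i) ^ 2) μ)
    (hz : 0 < z)
    (hIntK : ∀ i j, Integrable (fun x => ψ x i * ψ x j) μ)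
    (K : Matrix (Fin n) (Fin n) ℝ)
    (hKdef : K = Matrix.of fun i j => ∫ x, ψ x i * ψ x j ∂μ)
    (hIntc : ∀ (x₂ : X₂) i j, Integrable (fun x₁ => ψ (x₁, x₂) i * ψ (x₁, x₂) j) (κ x₂))
    (Kc : X₂ → Matrix (Fin n) (Fin n) ℝ)
    (hKc : Kc = fun x₂ => Matrix.of fun i j => ∫ x₁, ψ (x₁, x₂) i * ψ (x₁, x₂) j ∂(κ x₂)) :
    (μ.withDensity fun x =>
        ENNReal.ofReal ((∑ i, (Θ.mulVec (ψ x) i) ^ 2) / z)).map Prod.snd =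
      μ₂.withDensity fun x₂ =>
        ENNReal.ofReal ((Θᵀ * Θ * Kc x₂).trace / (Θᵀ * Θ * K).trace) := by
  have hmeas : Measurable fun x =>
      ENNReal.ofReal ((∑ i, (Θ.mulVec (ψ x) i) ^ 2) / z) := by
    have : Measurable fun x => ∑ i, (Θ.mulVec (ψ x) i) ^ 2 := by
      simp only [Matrix.mulVec, dotProduct]
      fun_prop
    fun_prop
  have hzK : (Θᵀ * Θ * K).trace = z := by
    rw [hzdef, hKdef, integral_sum_mulVec_sq Θ hIntK]
  ext s hs
  rw [Measure.map_apply measurable_snd hs, withDensity_apply _ (measurable_snd hs),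
    withDensity_apply _ hs, hdis,
    setLIntegral_map (measurable_snd hs) hmeas measurable_swap,
    show Prod.swap ⁻¹' (Prod.snd ⁻¹' s) = s ×ˢ (Set.univ : Set X₁) by ext; simp]
  refine (Measure.setLIntegral_compProd (hmeas.comp measurable_swap) hs MeasurableSet.univ).trans ?_
  refine lintegral_congr fun x₂ => ?_
  rw [Measure.restrict_univ, hzK, hKc, ← integral_sum_mulVec_sq Θ (hIntc x₂), ← integral_div]
  exact (ofReal_integral_eq_lintegral_ofReal
    ((integrable_sum_mulVec_sq Θ (hIntc x₂)).div_const z)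
    (.of_forall fun x => by positivity)).symm
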